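/- For every t > 0, the function χ(x) := (1/2)·log(1+x) + φ(x)/(2t), where φ(x) = (arsinh √x)² = log²(√x + √(1+x)), is a Bernstein function: χ(0) = 0, χ ≥ 0 on [0,∞), χ is smooth on (0,∞), and (−1)^{n−1} χ^{(n)}(x) ≥ 0 for all integers n ≥ 1 and all x > 0. Consequently exp(−χ) is the Laplace transform of an infinitely divisible distribution (the size-biased law of 1/(2A_t), where A_t is the exponential functional of Brownian motion). -/

import Mathlib

open Real MeasureTheory
open Filter Topology ProbabilityTheory

lemma integral_exp_neg_mul_expMeasure_one {c : ℝ} (hc : 0 ≤ c) :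
    ∫ y, exp (-c * y) ∂(expMeasure 1) = (1 + c)⁻¹ := by
  have h : expMeasure 1 = volume.withDensity (exponentialPDF 1) := rfl
  have hm : Measurable (exponentialPDF 1) :=
    (measurable_exponentialPDFReal 1).ennreal_ofReal
  have hfin : ∀ᵐ y ∂(volume : Measure ℝ), exponentialPDF 1 y < ⊤ :=
    ae_of_all _ fun _ ↦ ENNReal.ofReal_lt_top
  rw [h, integral_withDensity_eq_integral_toReal_smul hm hfin]
  have key : (fun y ↦ (exponentialPDF 1 y).toReal • exp (-c * y)) =
      (Set.Ici 0).indicator fun y ↦ exp (-(1 + c) * y) := by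
    ext y
    by_cases hy : 0 ≤ y
    · rw [exponentialPDF_of_nonneg hy, ENNReal.toReal_ofReal (by positivity),
        Set.indicator_of_mem (Set.mem_Ici.2 hy), smul_eq_mul, one_mul, ← exp_add]
      ring_nf
    · rw [exponentialPDF_of_neg (not_le.1 hy), Set.indicator_of_notMem (by simpa using hy)]
      simp
  rw [key, integral_indicator measurableSet_Ici, integral_Ici_eq_integral_Ioi,
    integral_exp_mul_Ioi (by linarith)]
  rw [mul_zero, exp_zero, neg_div_neg_eq, one_div]

lemma ae_nonneg_expMeasure (r : ℝ) : ∀ᵐ y ∂(expMeasure r), 0 ≤ y := by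
  have h : expMeasure r = volume.withDensity (exponentialPDF r) := rfl
  have hm : Measurable (exponentialPDF r) :=
    (measurable_exponentialPDFReal r).ennreal_ofReal
  rw [h, ae_withDensity_iff hm]
  refine ae_of_all _ fun y hy ↦ ?_
  by_contra hneg
  exact hy (exponentialPDF_of_neg (not_le.1 hneg))

lemma integrable_exp_neg_mul {μ : Measure ℝ} [IsFiniteMeasure μ]
    (hμ : ∀ᵐ y ∂μ, 0 ≤ y) {x : ℝ} (hx : 0 ≤ x) : Integrable (fun y ↦ exp (-x * y)) μ := by
  refine Integrable.of_bound (by fun_prop) 1 ?_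
  filter_upwards [hμ] with y hy
  rw [norm_of_nonneg (exp_pos _).le, exp_le_one_iff]
  nlinarith

/-- A sub-probability mixture of exponential laws, completed by an atom at zero. -/
lemma exists_laplace_eq_one_sub_integral (σ : Measure ℝ) (hσ : σ Set.univ ≤ 1)
    (hpos : ∀ᵐ c ∂σ, 0 ≤ c) :
    ∃ P : Measure ℝ, IsProbabilityMeasure P ∧ (∀ᵐ y ∂P, 0 ≤ y) ∧
      ∀ x : ℝ, 0 ≤ x → ∫ y, exp (-x * y) ∂P = 1 - ∫ c, x * c / (1 + x * c) ∂σ := by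
  have : IsFiniteMeasure σ := ⟨hσ.trans_lt ENNReal.one_lt_top⟩
  have : IsProbabilityMeasure (expMeasure 1) := isProbabilityMeasure_expMeasure one_pos
  have hmul : Measurable fun p : ℝ × ℝ ↦ p.1 * p.2 := by fun_prop
  set Q : Measure ℝ := (σ.prod (expMeasure 1)).map fun p ↦ p.1 * p.2 with hQ
  have hQuniv : Q Set.univ = σ Set.univ := by
    rw [hQ, Measure.map_apply hmul .univ, Set.preimage_univ, ← Set.univ_prod_univ,
      Measure.prod_prod, measure_univ (μ := expMeasure 1), mul_one]
  have : IsFiniteMeasure Q := ⟨by rw [hQuniv]; exact measure_lt_top _ _⟩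
  have hQpos : ∀ᵐ y ∂Q, 0 ≤ y := by
    rw [hQ, ae_map_iff hmul.aemeasurable measurableSet_Ici]
    filter_upwards [Measure.quasiMeasurePreserving_fst.ae hpos,
      Measure.quasiMeasurePreserving_snd.ae (ae_nonneg_expMeasure 1)] with p h1 h2
    exact mul_nonneg h1 h2
  have hdpos : ∀ᵐ y ∂((1 - σ Set.univ) • Measure.dirac (0 : ℝ)), 0 ≤ y :=
    Measure.ae_smul_measure ((ae_dirac_iff measurableSet_Ici).2 le_rfl) _
  have hfin : (1 - σ Set.univ) ≠ ⊤ := (tsub_le_self.trans_lt ENNReal.one_lt_top).ne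
  refine ⟨(1 - σ Set.univ) • Measure.dirac 0 + Q, ⟨?_⟩, ?_, fun x hx ↦ ?_⟩
  · simp [hQuniv, tsub_add_cancel_of_le hσ]
  · exact ae_add_measure_iff.2 ⟨hdpos, hQpos⟩
  · have hint := integrable_exp_neg_mul hQpos hx
    have : IsFiniteMeasure ((1 - σ Set.univ) • Measure.dirac (0 : ℝ)) :=
      Measure.smul_finite _ hfin
    rw [integral_add_measure (integrable_exp_neg_mul hdpos hx) hint, integral_smul_measure,
      integral_dirac]
    have hQint : ∫ y, exp (-x * y) ∂Q = ∫ c, (1 + x * c)⁻¹ ∂σ := by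
      rw [hQ, integral_map hmul.aemeasurable (by fun_prop), integral_prod]
      · refine integral_congr_ae ?_
        filter_upwards [hpos] with c hc
        rw [← integral_exp_neg_mul_expMeasure_one (mul_nonneg hx hc)]
        refine integral_congr_ae (ae_of_all _ fun y ↦ ?_)
        simp only []
        ring_nf
      · exact (integrable_map_measure (by fun_prop) hmul.aemeasurable).1 hint
    have hInt : Integrable (fun c ↦ (1 + x * c)⁻¹) σ := by
      refine Integrable.of_bound (by fun_prop) 1 ?_
      filter_upwards [hpos] with c hc
      have := mul_nonneg hx hc
      rw [norm_of_nonneg (by positivity)]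
      exact inv_le_one_of_one_le₀ (by linarith)
    have hcompl : ∫ c, x * c / (1 + x * c) ∂σ = ∫ c, (1 - (1 + x * c)⁻¹) ∂σ := by
      refine integral_congr_ae ?_
      filter_upwards [hpos] with c hc
      have := mul_nonneg hx hc
      field_simp
      ring
    rw [hQint, hcompl, integral_sub (integrable_const _) hInt,
      ENNReal.toReal_sub_of_le hσ ENNReal.one_ne_top]
    simp only [exp_zero, mul_zero, smul_eq_mul, integral_const, Measure.real,
      ENNReal.toReal_one, mul_one]
    ring

lemma integral_exp_neg_mul_map_sum_pi (ν : Measure ℝ) [IsProbabilityMeasure ν] (n : ℕ) (x : ℝ) :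
    ∫ y, exp (-x * y) ∂(Measure.map (fun y : Fin n → ℝ => ∑ i, y i) (Measure.pi fun _ => ν)) =
      (∫ y, exp (-x * y) ∂ν) ^ n := by
  rw [integral_map (by fun_prop) (by fun_prop)]
  simp_rw [Finset.mul_sum, exp_sum]
  rw [integral_fintype_prod_eq_pow fun y ↦ exp (-x * y), Fintype.card_fin]

lemma ae_nonneg_map_sum_pi {ν : Measure ℝ} [IsProbabilityMeasure ν] (hν : ∀ᵐ y ∂ν, 0 ≤ y)
    (n : ℕ) :
    ∀ᵐ y ∂(Measure.map (fun y : Fin n → ℝ => ∑ i, y i) (Measure.pi fun _ => ν)), 0 ≤ y := by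
  rw [ae_map_iff (by fun_prop) measurableSet_Ici]
  have h (i : Fin n) : ∀ᵐ y ∂(Measure.pi fun _ : Fin n => ν), 0 ≤ y i :=
    (measurePreserving_eval (fun _ : Fin n => ν) i).quasiMeasurePreserving.ae hν
  filter_upwards [ae_all_iff.2 h] with y hy
  exact Finset.sum_nonneg fun i _ ↦ hy i

/-- A tail bound in terms of the Laplace transform near zero. -/
lemma measure_norm_gt_le_of_laplace {ν : Measure ℝ} [IsProbabilityMeasure ν]
    (hν : ∀ᵐ y ∂ν, 0 ≤ y) {G r : ℝ} (hr : 0 < r)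
    (hG : 1 - ∫ y, exp (-r⁻¹ * y) ∂ν ≤ G * r⁻¹) :
    ν {y | r < ‖y‖} ≤ ENNReal.ofReal (2 * (G * r⁻¹)) := by
  have hint := integrable_exp_neg_mul hν (inv_nonneg.2 hr.le)
  have hms : MeasurableSet {y : ℝ | r < ‖y‖} := measurableSet_lt measurable_const measurable_norm
  have hle : ν.real {y | r < ‖y‖} ≤ ∫ y, 2 * (1 - exp (-r⁻¹ * y)) ∂ν := by
    rw [← integral_indicator_one hms]
    refine integral_mono_ae ((integrable_const 1).indicator hms)
      (((integrable_const 1).sub hint).const_mul 2) ?_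
    filter_upwards [hν] with y hy
    have h1 : exp (-r⁻¹ * y) ≤ 1 := by
      rw [exp_le_one_iff]
      have := inv_pos.2 hr
      nlinarith
    by_cases hmem : y ∈ {y : ℝ | r < ‖y‖}
    · rw [Set.indicator_of_mem hmem]
      have hry : r < y := by simpa [abs_of_nonneg hy] using hmem
      have h2 : exp (-r⁻¹ * y) ≤ exp (-1) := by
        rw [exp_le_exp, neg_mul, neg_le_neg_iff, inv_mul_eq_div, le_div_iff₀ hr]
        linarith
      have h3 := exp_neg_one_lt_half
      simp only [Pi.one_apply]
      linarith
    · rw [Set.indicator_of_notMem hmem]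
      linarith
  rw [integral_const_mul, integral_sub (integrable_const _) hint] at hle
  simp only [integral_const, probReal_univ, smul_eq_mul, mul_one] at hle
  rw [← ofReal_measureReal]
  exact ENNReal.ofReal_le_ofReal (by linarith)

/-- A continuity theorem for Laplace transforms: pointwise limits of Laplace transforms of
probability laws on the half-line are such transforms, given equicontinuity at zero. -/
lemma exists_laplace_eq_of_tendsto (ν : ℕ → Measure ℝ) [∀ k, IsProbabilityMeasure (ν k)]
    (hν : ∀ k, ∀ᵐ y ∂(ν k), 0 ≤ y) {G : ℝ}
    (hG : ∀ k, ∀ x : ℝ, 0 ≤ x → 1 - ∫ y, exp (-x * y) ∂(ν k) ≤ G * x) {L : ℝ → ℝ}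
    (hL : ∀ x : ℝ, 0 ≤ x → Tendsto (fun k ↦ ∫ y, exp (-x * y) ∂(ν k)) atTop (𝓝 (L x))) :
    ∃ P : Measure ℝ, IsProbabilityMeasure P ∧
      ∀ x : ℝ, 0 ≤ x → ∫ y, exp (-x * y) ∂P = L x := by
  let p : ℕ → ProbabilityMeasure ℝ := fun k ↦ ⟨ν k, inferInstance⟩
  have htight : IsTightMeasureSet {((μ : ProbabilityMeasure ℝ) : Measure ℝ) | μ ∈ Set.range p} := by
    refine isTightMeasureSet_of_tendsto_measure_norm_gt ?_
    have hlim : Tendsto (fun r : ℝ ↦ ENNReal.ofReal (2 * (G * r⁻¹))) atTop (𝓝 0) := by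
      rw [← ENNReal.ofReal_zero]
      refine ENNReal.tendsto_ofReal ?_
      simpa using (tendsto_inv_atTop_zero.const_mul G).const_mul 2
    refine tendsto_of_tendsto_of_tendsto_of_le_of_le' tendsto_const_nhds hlim
      (.of_forall fun _ ↦ zero_le) ?_
    filter_upwards [eventually_gt_atTop 0] with r hr
    refine iSup₂_le ?_
    rintro _ ⟨_, ⟨k, rfl⟩, rfl⟩
    exact measure_norm_gt_le_of_laplace (hν k) hr (hG k _ (inv_nonneg.2 hr.le))
  have hcomp := isCompact_closure_of_isTightMeasureSet htight
  obtain ⟨q, -, φ, hφ, hq⟩ :=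
    hcomp.tendsto_subseq fun k ↦ subset_closure (Set.mem_range_self k)
  refine ⟨(q : Measure ℝ).map fun y ↦ max y 0, Measure.isProbabilityMeasure_map (by fun_prop),
    fun x hx ↦ ?_⟩
  rw [integral_map (by fun_prop) (by fun_prop)]
  let f : BoundedContinuousFunction ℝ ℝ :=
    BoundedContinuousFunction.ofNormedAddCommGroup (fun y ↦ exp (-x * max y 0)) (by fun_prop) 1
      fun y ↦ by
        rw [norm_of_nonneg (exp_pos _).le, exp_le_one_iff]
        have := le_max_right y 0
        nlinarith
  have h1 := ProbabilityMeasure.tendsto_iff_forall_integral_tendsto.1 hq f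
  refine tendsto_nhds_unique h1 (((hL x hx).comp hφ.tendsto_atTop).congr fun k ↦ ?_)
  refine integral_congr_ae ?_
  filter_upwards [hν (φ k)] with y hy
  simp [f, max_eq_left hy]

lemma integrable_div_one_add_mul {ρ : Measure ℝ} [IsFiniteMeasure ρ] (hρ : ∀ᵐ u ∂ρ, 0 ≤ u)
    {x ε : ℝ} (hx : 0 ≤ x) (hε : 0 ≤ ε) : Integrable (fun u ↦ x / (1 + x * (u + ε))) ρ := by
  have hm : Measurable fun u : ℝ ↦ x / (1 + x * (u + ε)) := by fun_prop
  refine Integrable.of_bound hm.aestronglyMeasurable x ?_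
  filter_upwards [hρ] with u hu
  rw [norm_of_nonneg (by positivity)]
  exact div_le_self hx (le_add_of_nonneg_right (by positivity))

/-- A complete Bernstein function with a shifted representing measure, scaled so as to become one
minus a Laplace transform. -/
lemma exists_laplace_eq_one_sub_shift (ρ : Measure ℝ) [IsFiniteMeasure ρ] (hρ : ∀ᵐ u ∂ρ, 0 ≤ u)
    {k ε : ℝ} (hk : 0 < k) (hε : 0 < ε) (hmass : ρ.real Set.univ ≤ k * ε) :
    ∃ P : Measure ℝ, IsProbabilityMeasure P ∧ (∀ᵐ y ∂P, 0 ≤ y) ∧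
      ∀ x : ℝ, 0 ≤ x →
        ∫ y, exp (-x * y) ∂P = 1 - k⁻¹ * ∫ u, x / (1 + x * (u + ε)) ∂ρ := by
  set d : ℝ → ENNReal := fun u ↦ ENNReal.ofReal ((k * (u + ε))⁻¹) with hd
  have hdm : Measurable d := by fun_prop
  have hshift : Measurable fun u : ℝ ↦ u + ε := by fun_prop
  set σ : Measure ℝ := (ρ.withDensity d).map fun u ↦ u + ε with hσ
  have hσ1 : σ Set.univ ≤ 1 := by
    rw [hσ, Measure.map_apply hshift .univ, Set.preimage_univ, withDensity_apply _ .univ,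
      Measure.restrict_univ]
    calc ∫⁻ u, d u ∂ρ ≤ ∫⁻ _, ENNReal.ofReal ((k * ε)⁻¹) ∂ρ := by
          refine lintegral_mono_ae ?_
          filter_upwards [hρ] with u hu
          refine ENNReal.ofReal_le_ofReal ?_
          gcongr
          linarith
      _ = ENNReal.ofReal ((k * ε)⁻¹ * ρ.real Set.univ) := by
          rw [lintegral_const, ENNReal.ofReal_mul (by positivity), ofReal_measureReal]
      _ ≤ 1 := by
          rw [ENNReal.ofReal_le_one, inv_mul_le_iff₀ (by positivity)]
          simpa using hmass
  have hσpos : ∀ᵐ c ∂σ, 0 ≤ c := by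
    rw [hσ, ae_map_iff hshift.aemeasurable measurableSet_Ici]
    filter_upwards [(withDensity_absolutelyContinuous ρ d).ae_le hρ] with u hu
    positivity
  obtain ⟨P, hP, hPpos, hPL⟩ := exists_laplace_eq_one_sub_integral σ hσ1 hσpos
  refine ⟨P, hP, hPpos, fun x hx ↦ ?_⟩
  have hm : Measurable fun c : ℝ ↦ x * c / (1 + x * c) := by fun_prop
  rw [hPL x hx, hσ, integral_map hshift.aemeasurable hm.aestronglyMeasurable,
    integral_withDensity_eq_integral_toReal_smul hdm (ae_of_all _ fun _ ↦ ENNReal.ofReal_lt_top),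
    ← integral_const_mul]
  congr 1
  refine integral_congr_ae ?_
  filter_upwards [hρ] with u hu
  have h1 : 0 < u + ε := by linarith
  have h2 : 0 < 1 + x * (u + ε) := by positivity
  simp only [hd, smul_eq_mul]
  rw [ENNReal.toReal_ofReal (by positivity)]
  field_simp

/-- The exponential of minus a complete Bernstein function with finite representing measure on the
half-line is the Laplace transform of a probability law. -/
lemma exists_laplace_eq_exp_neg_integral (ρ : Measure ℝ) [IsFiniteMeasure ρ]
    (hρ : ∀ᵐ u ∂ρ, 0 ≤ u) :
    ∃ P : Measure ℝ, IsProbabilityMeasure P ∧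
      ∀ x : ℝ, 0 ≤ x → ∫ y, exp (-x * y) ∂P = exp (-∫ u, x / (1 + x * u) ∂ρ) := by
  set G : ℝ := ρ.real Set.univ + 1 with hGdef
  have hG : 0 < G := by positivity
  have hstep (k : ℕ) := exists_laplace_eq_one_sub_shift ρ hρ (k := k + 1) (ε := G / (k + 1))
    (by positivity) (by positivity) (by rw [mul_div_cancel₀ _ (by positivity)]; linarith)
  choose P hP hPpos hPL using hstep
  set f : ℕ → ℝ → ℝ := fun k x ↦ ∫ u, x / (1 + x * (u + G / (k + 1))) ∂ρ with hf
  have hf0 (k : ℕ) (x : ℝ) (hx : 0 ≤ x) : f k x ≤ G * x := by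
    calc f k x ≤ ∫ _, x ∂ρ := by
          refine integral_mono_ae (integrable_div_one_add_mul hρ hx (by positivity))
            (integrable_const _) ?_
          filter_upwards [hρ] with u hu
          exact div_le_self hx (le_add_of_nonneg_right (by positivity))
      _ ≤ G * x := by
          rw [integral_const, smul_eq_mul]
          gcongr
          linarith
  have hflim (x : ℝ) (hx : 0 ≤ x) :
      Tendsto (fun k ↦ f k x) atTop (𝓝 (∫ u, x / (1 + x * u) ∂ρ)) := by
    refine tendsto_integral_of_dominated_convergence (fun _ ↦ x) (fun k ↦ ?_)
      (integrable_const _) (fun k ↦ ?_) ?_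
    · exact (integrable_div_one_add_mul hρ hx (by positivity)).aestronglyMeasurable
    · filter_upwards [hρ] with u hu
      rw [norm_of_nonneg (by positivity)]
      exact div_le_self hx (le_add_of_nonneg_right (by positivity))
    · filter_upwards [hρ] with u hu
      have h0 : Tendsto (fun k : ℕ ↦ G / ((k : ℝ) + 1)) atTop (𝓝 0) := by
        simpa [div_eq_mul_inv] using
          (tendsto_one_div_add_atTop_nhds_zero_nat (𝕜 := ℝ)).const_mul G
      refine Tendsto.div tendsto_const_nhds ?_ (by positivity)
      simpa using ((h0.const_add u).const_mul x).const_add 1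
  let ν : ℕ → Measure ℝ := fun k ↦
    Measure.map (fun y : Fin (k + 1) → ℝ => ∑ i, y i) (Measure.pi fun _ => P k)
  have hνprob (k : ℕ) : IsProbabilityMeasure (ν k) :=
    Measure.isProbabilityMeasure_map (by fun_prop)
  have hνL (k : ℕ) (x : ℝ) (hx : 0 ≤ x) :
      ∫ y, exp (-x * y) ∂(ν k) = (1 - ((k : ℝ) + 1)⁻¹ * f k x) ^ (k + 1) := by
    rw [integral_exp_neg_mul_map_sum_pi, hPL k x hx]
  refine exists_laplace_eq_of_tendsto ν (fun k ↦ ae_nonneg_map_sum_pi (hPpos k) _) (G := G)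
    (fun k x hx ↦ ?_) (fun x hx ↦ ?_)
  · have hnn : 0 ≤ 1 - ((k : ℝ) + 1)⁻¹ * f k x := by
      rw [← hPL k x hx]
      exact integral_nonneg fun _ ↦ (exp_pos _).le
    have hB := one_add_mul_le_pow (a := -(((k : ℝ) + 1)⁻¹ * f k x)) (by linarith) (k + 1)
    rw [hνL k x hx]
    have hc : ((k + 1 : ℕ) : ℝ) * -(((k : ℝ) + 1)⁻¹ * f k x) = -f k x := by
      push_cast
      field_simp
    rw [hc, ← sub_eq_add_neg, ← sub_eq_add_neg] at hB
    linarith [hf0 k x hx]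
  · have hlim : Tendsto (fun m : ℕ ↦ (1 + -((m : ℝ)⁻¹ * f (m - 1) x)) ^ m) atTop
        (𝓝 (exp (-∫ u, x / (1 + x * u) ∂ρ))) := by
      refine Real.tendsto_one_add_pow_exp_of_tendsto ?_
      refine (((hflim x hx).comp (tendsto_sub_atTop_nat 1)).neg).congr' ?_
      filter_upwards [eventually_gt_atTop 0] with m hm
      have : (m : ℝ) ≠ 0 := by positivity
      simp only [Function.comp_apply]
      field_simp
    refine (hlim.comp (tendsto_add_atTop_nat 1)).congr fun k ↦ ?_
    rw [hνL k x hx]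
    simp [sub_eq_add_neg]

/-- Probability laws on the real line are determined by their Laplace transform on the half-line,
provided that it is finite there. -/
lemma measure_ext_of_laplace_eq {μ ν : Measure ℝ} [IsProbabilityMeasure μ]
    [IsProbabilityMeasure ν] (hμ : ∀ x : ℝ, 0 ≤ x → Integrable (fun y ↦ exp (-x * y)) μ)
    (hν : ∀ x : ℝ, 0 ≤ x → Integrable (fun y ↦ exp (-x * y)) ν)
    (h : ∀ x : ℝ, 0 ≤ x → ∫ y, exp (-x * y) ∂μ = ∫ y, exp (-x * y) ∂ν) : μ = ν := by
  have hsub {κ : Measure ℝ} (hκ : ∀ x : ℝ, 0 ≤ x → Integrable (fun y ↦ exp (-x * y)) κ) :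
      Set.Iio 0 ⊆ interior (integrableExpSet id κ) := by
    refine interior_maximal (fun s hs ↦ ?_) isOpen_Iio
    simpa [integrableExpSet] using hκ (-s) (by simpa using (Set.mem_Iio.1 hs).le)
  have han {κ : Measure ℝ} (hκ : ∀ x : ℝ, 0 ≤ x → Integrable (fun y ↦ exp (-x * y)) κ) :
      AnalyticOnNhd ℂ (complexMGF id κ) {z | z.re < 0} :=
    analyticOnNhd_complexMGF.mono fun z hz ↦ hsub hκ hz
  have heq : Set.EqOn (complexMGF id μ) (complexMGF id ν) {z | z.re < 0} := by
    refine (han hμ).eqOn_of_preconnected_of_frequently_eq (han hν)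
      (convex_halfSpace_re_lt 0).isPreconnected (z₀ := ((-1 : ℝ) : ℂ)) (by simp) ?_
    have hfreq : ∃ᶠ s : ℝ in 𝓝[≠] (-1), complexMGF id μ s = complexMGF id ν s := by
      refine Eventually.frequently ?_
      filter_upwards [mem_nhdsWithin_of_mem_nhds (Iio_mem_nhds (by norm_num : (-1 : ℝ) < 0))]
        with s hs
      rw [complexMGF_ofReal, complexMGF_ofReal]
      congr 1
      simpa [mgf] using h (-s) (by simpa using (Set.mem_Iio.1 hs).le)
    refine Filter.Tendsto.frequently ?_ hfreq
    refine tendsto_nhdsWithin_iff.2 ⟨?_, ?_⟩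
    · exact (Complex.continuous_ofReal.tendsto _).mono_left nhdsWithin_le_nhds
    · filter_upwards [self_mem_nhdsWithin] with s hs
      exact fun hs' ↦ hs (Complex.ofReal_injective hs')
  have hlim {κ : Measure ℝ} [IsProbabilityMeasure κ]
      (hκ : ∀ x : ℝ, 0 ≤ x → Integrable (fun y ↦ exp (-x * y)) κ) (s : ℝ) :
      Tendsto (fun k : ℕ ↦ complexMGF id κ (-(1 / ((k : ℝ) + 1) : ℝ) + s * Complex.I)) atTop
        (𝓝 (charFun κ s)) := by
    rw [← complexMGF_id_mul_I]
    refine tendsto_integral_of_dominated_convergence (fun y ↦ 1 + exp (-1 * y)) (fun k ↦ ?_)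
      ((integrable_const _).add (hκ 1 zero_le_one)) (fun k ↦ ae_of_all _ fun y ↦ ?_)
      (ae_of_all _ fun y ↦ ?_)
    · fun_prop
    · have hk1 : 1 / ((k : ℝ) + 1) ≤ 1 := by
        rw [div_le_one (by positivity)]
        linarith [Nat.cast_nonneg (α := ℝ) k]
      have hk0 : 0 ≤ 1 / ((k : ℝ) + 1) := by positivity
      generalize 1 / ((k : ℝ) + 1) = e at hk0 hk1 ⊢
      have hre : ((-(e : ℂ) + s * Complex.I) * (id y : ℝ)).re = -e * y := by simp
      rw [Complex.norm_exp, hre]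
      rcases le_total 0 y with hy | hy
      · have : exp (-e * y) ≤ 1 := by
          rw [exp_le_one_iff]
          nlinarith
        linarith [exp_pos (-1 * y)]
      · have : exp (-e * y) ≤ exp (-1 * y) := by
          rw [exp_le_exp]
          nlinarith
        linarith
    · refine (Complex.continuous_exp.tendsto _).comp (Tendsto.mul_const _ ?_)
      have h0 := (Complex.continuous_ofReal.tendsto _).comp
        (tendsto_one_div_add_atTop_nhds_zero_nat (𝕜 := ℝ))
      simpa using h0.neg.add_const ((s : ℂ) * Complex.I)
  refine Measure.ext_of_charFun (funext fun s ↦ ?_)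
  refine tendsto_nhds_unique (hlim hμ s) ((hlim hν s).congr fun k ↦ (heq ?_).symm)
  have : 0 < 1 / ((k : ℝ) + 1) := by positivity
  generalize 1 / ((k : ℝ) + 1) = e at this ⊢
  simpa using this

lemma hasDerivAt_integral_pow_div_pow {ρ : Measure ℝ} [IsFiniteMeasure ρ]
    (hρ : ∀ᵐ u ∂ρ, u ∈ Set.Icc (0 : ℝ) 1) (n : ℕ) {x : ℝ} (hx : 0 < x) :
    HasDerivAt (fun x ↦ ∫ u, u ^ n / (1 + x * u) ^ (n + 2) ∂ρ)
      (-(n + 2) * ∫ u, u ^ (n + 1) / (1 + x * u) ^ (n + 3) ∂ρ) x := by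
  have hmeas (m k : ℕ) (x : ℝ) : AEStronglyMeasurable (fun u : ℝ ↦ u ^ m / (1 + x * u) ^ k) ρ :=
    Measurable.aestronglyMeasurable (by fun_prop)
  have hbound (m k : ℕ) {x u : ℝ} (hx : 0 < x) (hu : u ∈ Set.Icc (0 : ℝ) 1) :
      ‖u ^ m / (1 + x * u) ^ k‖ ≤ 1 := by
    have h0 := hu.1
    have h1 : 1 ≤ (1 + x * u) ^ k := one_le_pow₀ (by nlinarith)
    rw [norm_of_nonneg (by positivity)]
    exact (div_le_self (by positivity) h1).trans (pow_le_one₀ hu.1 hu.2)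
  rw [← integral_const_mul]
  refine (hasDerivAt_integral_of_dominated_loc_of_deriv_le (bound := fun _ ↦ (n : ℝ) + 2)
    (F := fun x u ↦ u ^ n / (1 + x * u) ^ (n + 2))
    (F' := fun x u ↦ -((n : ℝ) + 2) * (u ^ (n + 1) / (1 + x * u) ^ (n + 3)))
    (Ioi_mem_nhds hx) (.of_forall fun y ↦ hmeas _ _ y) ?_
    ((hmeas _ _ x).const_mul _) ?_ (integrable_const _) ?_).2
  · refine Integrable.of_bound (hmeas _ _ x) 1 ?_
    filter_upwards [hρ] with u hu using hbound _ _ hx hu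
  · filter_upwards [hρ] with u hu y hy
    rw [norm_mul, norm_neg, norm_of_nonneg (by positivity)]
    exact mul_le_of_le_one_right (by positivity) (hbound _ _ hy hu)
  · filter_upwards [hρ] with u hu y hy
    have hpos : 0 < 1 + y * u := by
      have := mul_nonneg (Set.mem_Ioi.1 hy).le hu.1
      linarith
    have h1 : HasDerivAt (fun y : ℝ ↦ 1 + y * u) u y := by
      simpa using ((hasDerivAt_id y).mul_const u).const_add 1
    have h2 := (hasDerivAt_const y (u ^ n)).fun_div (h1.fun_pow (n + 2)) (by positivity)
    convert! h2 using 1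
    push_cast
    field_simp
    simp
    ring

lemma hasDerivAt_integral_div_one_add_mul {ρ : Measure ℝ} [IsFiniteMeasure ρ]
    (hρ : ∀ᵐ u ∂ρ, u ∈ Set.Icc (0 : ℝ) 1) {x : ℝ} (hx : 0 < x) :
    HasDerivAt (fun x ↦ ∫ u, x / (1 + x * u) ∂ρ) (∫ u, 1 / (1 + x * u) ^ 2 ∂ρ) x := by
  have hmeas (x : ℝ) : AEStronglyMeasurable (fun u : ℝ ↦ x / (1 + x * u)) ρ :=
    Measurable.aestronglyMeasurable (by fun_prop)
  refine (hasDerivAt_integral_of_dominated_loc_of_deriv_le (bound := fun _ ↦ (1 : ℝ))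
    (F := fun x u ↦ x / (1 + x * u)) (F' := fun x u ↦ 1 / (1 + x * u) ^ 2)
    (Ioi_mem_nhds hx) (.of_forall fun y ↦ hmeas y) ?_
    (Measurable.aestronglyMeasurable (by fun_prop)) ?_ (integrable_const _) ?_).2
  · refine Integrable.of_bound (hmeas x) x ?_
    filter_upwards [hρ] with u hu
    have := mul_nonneg hx.le hu.1
    rw [norm_of_nonneg (by positivity)]
    exact div_le_self hx.le (by linarith)
  · filter_upwards [hρ] with u hu y hy
    have := mul_nonneg (Set.mem_Ioi.1 hy).le hu.1
    rw [norm_of_nonneg (by positivity)]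
    exact div_le_self zero_le_one (one_le_pow₀ (by linarith))
  · filter_upwards [hρ] with u hu y hy
    have hpos : 0 < 1 + y * u := by
      have := mul_nonneg (Set.mem_Ioi.1 hy).le hu.1
      linarith
    have h1 : HasDerivAt (fun y : ℝ ↦ 1 + y * u) u y := by
      simpa using ((hasDerivAt_id y).mul_const u).const_add 1
    convert! (hasDerivAt_id y).fun_div h1 hpos.ne' using 1
    field_simp
    simp
    ring

lemma iteratedDeriv_integral_div_one_add_mul {ρ : Measure ℝ} [IsFiniteMeasure ρ]
    (hρ : ∀ᵐ u ∂ρ, u ∈ Set.Icc (0 : ℝ) 1) (n : ℕ) {x : ℝ} (hx : 0 < x) :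
    iteratedDeriv (n + 1) (fun x ↦ ∫ u, x / (1 + x * u) ∂ρ) x =
      (-1) ^ n * (n + 1).factorial * ∫ u, u ^ n / (1 + x * u) ^ (n + 2) ∂ρ := by
  induction n generalizing x with
  | zero => simpa using (hasDerivAt_integral_div_one_add_mul hρ hx).deriv
  | succ n ih =>
    rw [iteratedDeriv_succ]
    have heq : iteratedDeriv (n + 1) (fun x ↦ ∫ u, x / (1 + x * u) ∂ρ) =ᶠ[𝓝 x] fun x ↦
        (-1) ^ n * (n + 1).factorial * ∫ u, u ^ n / (1 + x * u) ^ (n + 2) ∂ρ := by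
      filter_upwards [Ioi_mem_nhds hx] with y hy using ih hy
    rw [heq.deriv_eq, ((hasDerivAt_integral_pow_div_pow hρ n hx).const_mul _).deriv,
      Nat.factorial_succ (n + 1)]
    push_cast
    ring

lemma continuousOn_integral_div_one_add_mul {ρ : Measure ℝ} [IsFiniteMeasure ρ]
    (hρ : ∀ᵐ u ∂ρ, 0 ≤ u) :
    ContinuousOn (fun x ↦ ∫ u, x / (1 + x * u) ∂ρ) (Set.Ici 0) := by
  intro x hx
  refine continuousWithinAt_of_dominated (bound := fun _ ↦ x + 1)
    (.of_forall fun y ↦ Measurable.aestronglyMeasurable (by fun_prop)) ?_ (integrable_const _) ?_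
  · filter_upwards [self_mem_nhdsWithin, mem_nhdsWithin_of_mem_nhds (Iio_mem_nhds (lt_add_one x))]
      with y hy hyx
    filter_upwards [hρ] with u hu
    have hy0 : 0 ≤ y := hy
    have := mul_nonneg hy0 hu
    rw [norm_of_nonneg (by positivity)]
    exact (div_le_self hy0 (by linarith)).trans (Set.mem_Iio.1 hyx).le
  · filter_upwards [hρ] with u hu
    have := mul_nonneg (Set.mem_Ici.1 hx) hu
    exact ContinuousAt.continuousWithinAt (by fun_prop (disch := positivity))

lemma hasDerivAt_artanh {s : ℝ} (hs : s ∈ Set.Ioo (-1 : ℝ) 1) :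
    HasDerivAt artanh (1 / (1 - s ^ 2)) s := by
  obtain ⟨h1, h2⟩ := hs
  have heq : artanh =ᶠ[𝓝 s] fun s ↦ 1 / 2 * (log (1 + s) - log (1 - s)) := by
    filter_upwards [Ioo_mem_nhds h1 h2] with y hy
    rw [artanh_eq_half_log ⟨hy.1.le, hy.2.le⟩, log_div (by linarith [hy.1]) (by linarith [hy.2])]
  have hp := ((hasDerivAt_id s).const_add 1).log (by simp; linarith)
  have hm := ((hasDerivAt_id s).const_sub 1).log (by simp; linarith)
  refine (((hp.sub hm).const_mul (1 / 2)).congr_deriv ?_).congr_of_eventuallyEq heq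
  have e1 : 1 + s ≠ 0 := by linarith
  have e2 : 1 - s ≠ 0 := by linarith
  have e3 : 1 - s ^ 2 = (1 + s) * (1 - s) := by ring
  rw [e3]
  simp only [id]
  field_simp
  ring

lemma continuousOn_one_sub_sq_mul_artanh :
    ContinuousOn (fun s ↦ (1 - s ^ 2) * artanh s) (Set.Icc 0 1) := by
  have hlog := continuous_mul_log.comp
    (continuous_const.sub continuous_id : Continuous fun s : ℝ ↦ 1 - s)
  have hcont : ContinuousOn (fun s : ℝ ↦ (1 - s ^ 2) / 2 * log (1 + s) -
      (1 + s) / 2 * ((1 - s) * log (1 - s))) (Set.Icc 0 1) := by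
    refine ContinuousOn.sub (ContinuousOn.mul (by fun_prop) ?_)
      (ContinuousOn.mul (by fun_prop) hlog.continuousOn)
    refine ContinuousOn.log (by fun_prop) fun s hs ↦ ?_
    have := hs.1
    positivity
  refine hcont.congr fun s hs ↦ ?_
  rcases hs.2.eq_or_lt with rfl | h
  · simp
  · have h0 := hs.1
    simp only []
    rw [artanh_eq_half_log ⟨by linarith, h.le⟩, log_div (by positivity) (by linarith)]
    ring

lemma intervalIntegrable_two_mul_artanh :
    IntervalIntegrable (fun s ↦ 2 * s * artanh s) volume 0 1 := by
  refine intervalIntegral.intervalIntegrable_deriv_of_nonneg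
    (g := fun s ↦ s - (1 - s ^ 2) * artanh s) ?_ ?_ ?_
  · rw [Set.uIcc_of_le zero_le_one]
    exact continuousOn_id.sub continuousOn_one_sub_sq_mul_artanh
  · intro s hs
    simp only [zero_le_one, inf_of_le_left, sup_of_le_right] at hs
    have hne : 1 - s ^ 2 ≠ 0 := by nlinarith [hs.1, hs.2]
    have hsq : HasDerivAt (fun s : ℝ ↦ 1 - s ^ 2) (-(2 * s)) s := by
      simpa using (hasDerivAt_pow 2 s).const_sub 1
    refine ((hasDerivAt_id s).sub
      (hsq.mul (hasDerivAt_artanh ⟨by linarith [hs.1], hs.2⟩))).congr_deriv ?_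
    field_simp
    ring
  · intro s hs
    simp only [zero_le_one, inf_of_le_left, sup_of_le_right] at hs
    have h0 := hs.1
    have := artanh_nonneg h0.le
    positivity

lemma artanh_sqrt_div_one_add {x : ℝ} (hx : 0 ≤ x) : artanh (√(x / (1 + x))) = arsinh √x := by
  rw [← artanh_tanh (arsinh √x), tanh_eq_sinh_div_cosh, sinh_arsinh, cosh_arsinh, sq_sqrt hx,
    sqrt_div hx]

lemma integral_artanh_div_sq {x : ℝ} (hx : 0 < x) :
    ∫ s in (0 : ℝ)..1, 2 * s * artanh s * (1 / (1 + x * (1 - s ^ 2)) ^ 2) =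
      arsinh √x / √(x * (1 + x)) := by
  set c : ℝ := √(x / (1 + x)) with hc
  have hc0 : 0 < c := sqrt_pos.2 (by positivity)
  have hc2 : c ^ 2 = x / (1 + x) := sq_sqrt (by positivity)
  have hc1 : c < 1 := by
    rw [hc, sqrt_lt' one_pos, one_pow, div_lt_one (by positivity)]
    linarith
  have hd : √(x * (1 + x)) = (1 + x) * c := by
    rw [sqrt_eq_iff_eq_sq (by positivity) (by positivity), mul_pow, hc2]
    field_simp
  have hden {s : ℝ} (hs : s ∈ Set.Icc (0 : ℝ) 1) : 0 < 1 + x * (1 - s ^ 2) := by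
    have : 0 ≤ 1 - s ^ 2 := by nlinarith [hs.1, hs.2]
    positivity
  have hcs {s : ℝ} (hs : s ∈ Set.Icc (0 : ℝ) 1) : c * s ∈ Set.Ioo (-1 : ℝ) 1 :=
    ⟨by nlinarith [hs.1, hs.2], by nlinarith [hs.1, hs.2]⟩
  set A : ℝ → ℝ := fun s ↦ artanh (c * s) / ((1 + x) * c) -
    (1 - s ^ 2) * artanh s / (1 + x * (1 - s ^ 2)) with hA
  have hAcont : ContinuousOn A (Set.Icc 0 1) := by
    refine ContinuousOn.sub (ContinuousOn.div_const ?_ _)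
      (continuousOn_one_sub_sq_mul_artanh.div (by fun_prop) fun s hs ↦ (hden hs).ne')
    intro s hs
    exact ((hasDerivAt_artanh (hcs hs)).continuousAt.comp
      (f := fun s ↦ c * s) (by fun_prop)).continuousWithinAt
  have hAderiv : ∀ s ∈ Set.Ioo (0 : ℝ) 1,
      HasDerivAt A (2 * s * artanh s * (1 / (1 + x * (1 - s ^ 2)) ^ 2)) s := by
    intro s hs
    have hs' : s ∈ Set.Icc (0 : ℝ) 1 := ⟨hs.1.le, hs.2.le⟩
    have hne : 1 - s ^ 2 ≠ 0 := by nlinarith [hs.1, hs.2]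
    have hDne := (hden hs').ne'
    have hsq : HasDerivAt (fun s : ℝ ↦ 1 - s ^ 2) (-(2 * s)) s := by
      simpa using (hasDerivAt_pow 2 s).const_sub 1
    have h1 : HasDerivAt (fun s ↦ artanh (c * s)) (1 / (1 - (c * s) ^ 2) * c) s :=
      (hasDerivAt_artanh (hcs hs')).comp s (by simpa using (hasDerivAt_id s).const_mul c)
    have h2 := hsq.fun_mul (hasDerivAt_artanh ⟨by linarith [hs.1], hs.2⟩)
    have h3 : HasDerivAt (fun s : ℝ ↦ 1 + x * (1 - s ^ 2)) (x * -(2 * s)) s :=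
      (hsq.const_mul x).const_add 1
    refine ((h1.div_const ((1 + x) * c)).sub (h2.fun_div h3 hDne)).congr_deriv ?_
    have e : 1 / (1 - (c * s) ^ 2) * c / ((1 + x) * c) = 1 / (1 + x * (1 - s ^ 2)) := by
      have e1 : 1 - (c * s) ^ 2 = (1 + x * (1 - s ^ 2)) / (1 + x) := by
        rw [mul_pow, hc2]
        field_simp
        ring
      rw [e1]
      field_simp
    rw [e]
    field_simp
    ring
  have hint : IntervalIntegrable
      (fun s ↦ 2 * s * artanh s * (1 / (1 + x * (1 - s ^ 2)) ^ 2)) volume 0 1 := by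
    refine intervalIntegrable_two_mul_artanh.mul_continuousOn ?_
    rw [Set.uIcc_of_le zero_le_one]
    exact ContinuousOn.div (by fun_prop) (by fun_prop) fun s hs ↦ (pow_pos (hden hs) 2).ne'
  rw [intervalIntegral.integral_eq_sub_of_hasDerivAt_of_le zero_le_one hAcont hAderiv hint, hd,
    ← artanh_sqrt_div_one_add hx.le]
  simp [hA, hc]

lemma hasDerivAt_arsinh_sqrt_sq {x : ℝ} (hx : 0 < x) :
    HasDerivAt (fun x ↦ arsinh √x ^ 2) (arsinh √x / √(x * (1 + x))) x := by
  have h := ((hasDerivAt_sqrt hx.ne').arsinh).fun_pow 2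
  refine h.congr_deriv ?_
  rw [sq_sqrt hx.le, sqrt_mul hx.le]
  have h1 : 0 < √x := sqrt_pos.2 hx
  have h2 : 0 < √(1 + x) := sqrt_pos.2 (by linarith)
  simp
  field_simp

/-- The representing measure of `(arsinh √x) ^ 2` as a complete Bernstein function. -/
lemma exists_measure_arsinh_sqrt_sq :
    ∃ ρ : Measure ℝ, IsFiniteMeasure ρ ∧ (∀ᵐ u ∂ρ, u ∈ Set.Icc (0 : ℝ) 1) ∧
      ∀ x : ℝ, 0 ≤ x → arsinh √x ^ 2 = ∫ u, x / (1 + x * u) ∂ρ := by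
  set d : ℝ → ENNReal := fun s ↦ ENNReal.ofReal (2 * s * artanh s) with hd
  have hart : Measurable artanh := by
    unfold artanh
    fun_prop
  have hdm : Measurable d := by fun_prop
  have hmap : Measurable fun s : ℝ ↦ 1 - s ^ 2 := by fun_prop
  have hint := (intervalIntegrable_iff_integrableOn_Ioc_of_le zero_le_one).1
    intervalIntegrable_two_mul_artanh
  have hfin : IsFiniteMeasure ((volume.restrict (Set.Ioc (0 : ℝ) 1)).withDensity d) :=
    isFiniteMeasure_withDensity_ofReal hint.2
  set ρ : Measure ℝ := ((volume.restrict (Set.Ioc (0 : ℝ) 1)).withDensity d).map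
    fun s ↦ 1 - s ^ 2 with hρdef
  have hρfin : IsFiniteMeasure ρ := inferInstance
  have hρ : ∀ᵐ u ∂ρ, u ∈ Set.Icc (0 : ℝ) 1 := by
    refine (ae_map_iff hmap.aemeasurable (p := fun u ↦ u ∈ Set.Icc (0 : ℝ) 1)
      measurableSet_Icc).2 ?_
    refine (withDensity_absolutelyContinuous _ d).ae_le ?_
    filter_upwards [ae_restrict_mem measurableSet_Ioc] with s hs
    constructor <;> nlinarith [hs.1, hs.2]
  have hderiv {x : ℝ} (hx : 0 < x) :
      ∫ u, 1 / (1 + x * u) ^ 2 ∂ρ = arsinh √x / √(x * (1 + x)) := by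
    rw [← integral_artanh_div_sq hx, hρdef, integral_map hmap.aemeasurable
      (Measurable.aestronglyMeasurable (by fun_prop)),
      integral_withDensity_eq_integral_toReal_smul hdm (ae_of_all _ fun _ ↦ ENNReal.ofReal_lt_top),
      intervalIntegral.integral_of_le zero_le_one]
    refine setIntegral_congr_fun measurableSet_Ioc fun s hs ↦ ?_
    have h0 := hs.1.le
    have h1 := artanh_nonneg h0
    simp only [hd, smul_eq_mul]
    rw [ENNReal.toReal_ofReal (by positivity)]
  set D : ℝ → ℝ := fun x ↦ arsinh √x ^ 2 - ∫ u, x / (1 + x * u) ∂ρ with hD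
  have hDcont : ContinuousOn D (Set.Ici 0) :=
    ((continuous_arsinh.comp continuous_sqrt).pow 2).continuousOn.sub
      (continuousOn_integral_div_one_add_mul (hρ.mono fun u hu ↦ hu.1))
  have hDderiv {x : ℝ} (hx : 0 < x) : HasDerivAt D 0 x :=
    ((hasDerivAt_arsinh_sqrt_sq hx).sub
      (hasDerivAt_integral_div_one_add_mul hρ hx)).congr_deriv (by rw [hderiv hx, sub_self])
  have hDdiff : DifferentiableOn ℝ D (interior (Set.Ici 0)) := by
    rw [interior_Ici]
    exact fun x hx ↦ (hDderiv hx).differentiableAt.differentiableWithinAt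
  have hDzero : ∀ x ∈ interior (Set.Ici (0 : ℝ)), deriv D x = 0 := by
    rw [interior_Ici]
    exact fun x hx ↦ (hDderiv hx).deriv
  have hmono := monotoneOn_of_deriv_nonneg (convex_Ici 0) hDcont hDdiff fun x hx ↦
    (hDzero x hx).ge
  have hanti := antitoneOn_of_deriv_nonpos (convex_Ici 0) hDcont hDdiff fun x hx ↦
    (hDzero x hx).le
  refine ⟨ρ, hρfin, hρ, fun x hx ↦ sub_eq_zero.1 ?_⟩
  have hD0 : D 0 = 0 := by simp [hD]
  have hmem : (0 : ℝ) ∈ Set.Ici (0 : ℝ) := Set.self_mem_Ici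
  exact le_antisymm ((hanti hmem hx hx).trans_eq hD0) (hD0.symm.le.trans (hmono hmem hx hx))

lemma log_one_add_eq_integral {x : ℝ} (hx : 0 ≤ x) :
    log (1 + x) = ∫ u in Set.Ioc (0 : ℝ) 1, x / (1 + x * u) := by
  have hpos {u : ℝ} (hu : u ∈ Set.uIcc (0 : ℝ) 1) : 0 < 1 + x * u := by
    rw [Set.uIcc_of_le zero_le_one] at hu
    have := mul_nonneg hx hu.1
    linarith
  have hderiv : ∀ u ∈ Set.uIcc (0 : ℝ) 1,
      HasDerivAt (fun u ↦ log (1 + x * u)) (x / (1 + x * u)) u := fun u hu ↦ by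
    have h1 : HasDerivAt (fun u : ℝ ↦ 1 + x * u) x u := by
      simpa using ((hasDerivAt_id u).const_mul x).const_add 1
    exact h1.log (hpos hu).ne'
  rw [← intervalIntegral.integral_of_le zero_le_one,
    intervalIntegral.integral_eq_sub_of_hasDerivAt hderiv]
  · simp
  · exact (ContinuousOn.div (by fun_prop) (by fun_prop)
      fun u hu ↦ (hpos hu).ne').intervalIntegrable

lemma exists_measure_log_add_arsinh_sqrt_sq {a b : ℝ} (ha : 0 ≤ a) (hb : 0 ≤ b) :
    ∃ ρ : Measure ℝ, IsFiniteMeasure ρ ∧ (∀ᵐ u ∂ρ, u ∈ Set.Icc (0 : ℝ) 1) ∧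
      ∀ x : ℝ, 0 ≤ x → a * log (1 + x) + b * arsinh √x ^ 2 = ∫ u, x / (1 + x * u) ∂ρ := by
  obtain ⟨ρ, hfin, hρ, hrep⟩ := exists_measure_arsinh_sqrt_sq
  set lam : Measure ℝ := volume.restrict (Set.Ioc 0 1) with hlam
  have hlamIcc : ∀ᵐ u ∂lam, u ∈ Set.Icc (0 : ℝ) 1 := by
    filter_upwards [ae_restrict_mem measurableSet_Ioc] with u hu using ⟨hu.1.le, hu.2⟩
  have hint {κ : Measure ℝ} [IsFiniteMeasure κ] (hκ : ∀ᵐ u ∂κ, u ∈ Set.Icc (0 : ℝ) 1)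
      {x : ℝ} (hx : 0 ≤ x) : Integrable (fun u ↦ x / (1 + x * u)) κ := by
    simpa using integrable_div_one_add_mul (hκ.mono fun u hu ↦ hu.1) hx le_rfl
  refine ⟨a.toNNReal • lam + b.toNNReal • ρ, inferInstance, ?_, fun x hx ↦ ?_⟩
  · exact ae_add_measure_iff.2
      ⟨Measure.ae_smul_measure hlamIcc _, Measure.ae_smul_measure hρ _⟩
  · rw [integral_add_measure ((hint hlamIcc hx).smul_measure_nnreal)
      ((hint hρ hx).smul_measure_nnreal), integral_smul_nnreal_measure,
      integral_smul_nnreal_measure, ← log_one_add_eq_integral hx, ← hrep x hx, NNReal.smul_def,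
      NNReal.smul_def, coe_toNNReal a ha, coe_toNNReal b hb, smul_eq_mul, smul_eq_mul]

theorem chi_is_bernstein_and_infinitely_divisible
    (t : ℝ) (ht : 0 < t)
    (χ : ℝ → ℝ)
    (hχ : ∀ x : ℝ, χ x = (1 / 2) * Real.log (1 + x) +
        (Real.arsinh (Real.sqrt x)) ^ 2 / (2 * t)) :
    χ 0 = 0 ∧
    (∀ x : ℝ, 0 ≤ x → 0 ≤ χ x) ∧
    ContDiffOn ℝ (⊤ : ℕ∞) χ (Set.Ioi 0) ∧
    (∀ n : ℕ, 1 ≤ n → ∀ x : ℝ, 0 < x →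
      0 ≤ (-1 : ℝ) ^ (n - 1) * iteratedDeriv n χ x) ∧
    (∀ μ : Measure ℝ, IsProbabilityMeasure μ →
      (∀ x : ℝ, 0 ≤ x → ∫ y, Real.exp (-x * y) ∂μ = Real.exp (-χ x)) →
      ∀ n : ℕ, 0 < n → ∃ ν : Measure ℝ, IsProbabilityMeasure ν ∧
        Measure.map (fun y : Fin n → ℝ => ∑ i, y i) (Measure.pi fun _ => ν) = μ) := by
  have hχ' : χ = fun x ↦ (1 / 2) * log (1 + x) + arsinh √x ^ 2 / (2 * t) := funext hχ
  refine ⟨by simp [hχ], fun x hx ↦ ?_, ?_, fun n hn x hx ↦ ?_, fun μ hμ hlap n hn ↦ ?_⟩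
  · rw [hχ]
    have := log_nonneg (show 1 ≤ 1 + x by linarith)
    positivity
  · rw [hχ']
    refine ContDiffOn.add (contDiffOn_const.mul (ContDiffOn.log (by fun_prop) fun x hx ↦ ?_))
      (ContDiffOn.div_const (ContDiffOn.pow (ContDiffOn.arsinh
        (contDiffOn_id.sqrt fun x hx ↦ (Set.mem_Ioi.1 hx).ne')) 2) _)
    have := Set.mem_Ioi.1 hx
    positivity
  · obtain ⟨ρ, hfin, hρ, hrep⟩ := exists_measure_log_add_arsinh_sqrt_sq (a := 1 / 2)
      (b := 1 / (2 * t)) (by positivity) (by positivity)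
    obtain ⟨m, rfl⟩ := Nat.exists_eq_add_of_le' hn
    have heq : χ =ᶠ[𝓝 x] fun x ↦ ∫ u, x / (1 + x * u) ∂ρ := by
      filter_upwards [Ioi_mem_nhds hx] with y hy
      rw [hχ, ← hrep y (Set.mem_Ioi.1 hy).le]
      ring
    rw [heq.iteratedDeriv_eq, iteratedDeriv_integral_div_one_add_mul hρ m hx,
      Nat.add_sub_cancel, ← mul_assoc, ← mul_assoc, ← mul_pow]
    have hnonneg : 0 ≤ ∫ u, u ^ m / (1 + x * u) ^ (m + 2) ∂ρ := by
      refine integral_nonneg_of_ae ?_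
      filter_upwards [hρ] with u hu
      have h0 := hu.1
      positivity
    norm_num
    positivity
  · obtain ⟨ρ, hfin, hρ, hrep⟩ := exists_measure_log_add_arsinh_sqrt_sq (a := 1 / (2 * n))
      (b := 1 / (2 * t * n)) (by positivity) (by positivity)
    obtain ⟨ν, hν, hνlap⟩ := exists_laplace_eq_exp_neg_integral ρ (hρ.mono fun u hu ↦ hu.1)
    have hpow (x : ℝ) (hx : 0 ≤ x) : ∫ y, exp (-x * y)
        ∂(Measure.map (fun y : Fin n → ℝ => ∑ i, y i) (Measure.pi fun _ => ν)) =
          exp (-χ x) := by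
      rw [integral_exp_neg_mul_map_sum_pi, hνlap x hx, ← exp_nat_mul, ← hrep x hx, hχ]
      congr 1
      field_simp
    have : IsProbabilityMeasure
        (Measure.map (fun y : Fin n → ℝ => ∑ i, y i) (Measure.pi fun _ => ν)) :=
      Measure.isProbabilityMeasure_map (by fun_prop)
    have hint {κ : Measure ℝ} (hκ : ∀ x, 0 ≤ x → ∫ y, exp (-x * y) ∂κ = exp (-χ x)) (x : ℝ)
        (hx : 0 ≤ x) : Integrable (fun y ↦ exp (-x * y)) κ :=
      not_imp_comm.1 integral_undef (by rw [hκ x hx]; exact (exp_pos _).ne')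
    exact ⟨ν, hν, measure_ext_of_laplace_eq (hint hpow) (hint hlap) fun x hx ↦
      (hpow x hx).trans (hlap x hx).symm⟩
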